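/- Let M = (Q, p₀, F, Δ) and M' = (Q', p₀', F', Δ') be s-AFAs over the same alphabet type α. Define their intersection M ∩ M' as the s-AFA over states Q ⊕ Q' whose accepting set is the union of the images of F and F' under inl and inr, whose transition set is the union of the images of Δ and Δ' (guards unchanged, target formulas mapped by subst (var ∘ inl) resp. subst (var ∘ inr)), and whose initial formula is and (subst (var ∘ inl) p₀) (subst (var ∘ inr) p₀'). Then the language of M ∩ M' equals L(M) ∩ L(M'). -/

import Mathlib

/-- Positive Boolean formulas over a type `Q`. -/
inductive PBF (Q : Type u) : Type u where
  | tt : PBF Q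
  | ff : PBF Q
  | var : Q → PBF Q
  | and : PBF Q → PBF Q → PBF Q
  | or : PBF Q → PBF Q → PBF Q

/-- Evaluation of a positive Boolean formula under a model `m : Q → Bool`. -/
def PBF.eval {Q : Type*} (m : Q → Bool) : PBF Q → Bool
  | .tt => true
  | .ff => false
  | .var q => m q
  | .and p q => p.eval m && q.eval m
  | .or p q => p.eval m || q.eval m

/-- Substitution: replace each variable `q` by `σ q`. -/
def PBF.subst {Q R : Type*} (σ : Q → PBF R) : PBF Q → PBF R
  | .tt => .tt
  | .ff => .ff
  | .var q => σ q
  | .and p q => .and (p.subst σ) (q.subst σ)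
  | .or p q => .or (p.subst σ) (q.subst σ)

/-- A symbolic alternating finite automaton over an alphabet type `α`. -/
structure SAFA (α : Type*) where
  /-- states -/
  Q : Type
  [fin : Fintype Q]
  /-- initial formula -/
  init : PBF Q
  /-- accepting states -/
  F : Set Q
  /-- transitions `(source, guard, target formula)` -/
  Δ : Finset (Q × Set α × PBF Q)

attribute [instance] SAFA.fin

/-- One-step transition function `Δ_a : Q → PBF Q`: the disjunction of all targets `q`
over transitions `(s, φ, q) ∈ Δ` with `a ∈ φ` (the empty disjunction is `ff`). -/
noncomputable def SAFA.step {α : Type*} (M : SAFA α) (a : α) (s : M.Q) : PBF M.Q :=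
  letI := Classical.propDecidable
  (M.Δ.toList.filter (fun t => decide (t.1 = s ∧ a ∈ t.2.1))).foldr
    (fun t acc => .or t.2.2 acc) .ff

/-- Transition function on words, extended to formulas by substitution:
`Δ_w = Δ_{aₙ} ∘ ⋯ ∘ Δ_{a₁}`. -/
noncomputable def SAFA.run {α : Type*} (M : SAFA α) (w : List α) (p : PBF M.Q) : PBF M.Q :=
  w.foldl (fun p a => p.subst (M.step a)) p

/-- `F̂ : PBF Q → Bool`: evaluation under the indicator function of the accepting set. -/
noncomputable def SAFA.Fhat {α : Type*} (M : SAFA α) (p : PBF M.Q) : Bool :=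
  letI := Classical.propDecidable
  p.eval (fun s => decide (s ∈ M.F))

/-- The language of a formula `p` in the s-AFA `M`. -/
noncomputable def SAFA.langOf {α : Type*} (M : SAFA α) (p : PBF M.Q) : Set (List α) :=
  { w : List α | M.Fhat (M.run w p) = true }

/-- The language of the s-AFA `M`. -/
noncomputable def SAFA.lang {α : Type*} (M : SAFA α) : Set (List α) :=
  M.langOf M.init

/-- The intersection of two s-AFAs: disjoint union of states and transitions, initial
formula the conjunction of the (injected) initial formulas. -/
noncomputable def SAFA.inter {α : Type*} (M M' : SAFA α) : SAFA α where
  Q := M.Q ⊕ M'.Q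
  init := .and (M.init.subst (.var ∘ Sum.inl)) (M'.init.subst (.var ∘ Sum.inr))
  F := (Sum.inl '' M.F) ∪ (Sum.inr '' M'.F)
  Δ :=
    letI := Classical.decEq ((M.Q ⊕ M'.Q) × Set α × PBF (M.Q ⊕ M'.Q))
    (M.Δ.image (fun t => (Sum.inl t.1, t.2.1, t.2.2.subst (.var ∘ Sum.inl)))) ∪
    (M'.Δ.image (fun t => (Sum.inr t.1, t.2.1, t.2.2.subst (.var ∘ Sum.inr))))

theorem PBF.eval_subst {Q R : Type*} (m : R → Bool) (σ : Q → PBF R) (p : PBF Q) :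
    (p.subst σ).eval m = p.eval (fun q => (σ q).eval m) := by
  induction p <;> simp_all [PBF.subst, PBF.eval]

theorem PBF.eval_foldr_or {Q ι : Type*} (m : Q → Bool) (f : ι → PBF Q) (l : List ι) :
    (l.foldr (fun t acc => PBF.or (f t) acc) .ff).eval m = true ↔
      ∃ t ∈ l, (f t).eval m = true := by
  induction l <;> simp_all [PBF.eval]

theorem PBF.eval_subst_var {Q R : Type*} (m : R → Bool) (f : Q → R) {m' : Q → Bool}
    (h : ∀ q, m (f q) = m' q) (p : PBF Q) : (p.subst (.var ∘ f)).eval m = p.eval m' :=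
  (PBF.eval_subst _ _ _).trans (congrArg (p.eval ·) (funext h))

theorem SAFA.eval_step {α : Type*} (M : SAFA α) (m : M.Q → Bool) (a : α) (s : M.Q) :
    (M.step a s).eval m = true ↔
      ∃ t ∈ M.Δ, t.1 = s ∧ a ∈ t.2.1 ∧ t.2.2.eval m = true := by
  simp only [SAFA.step, PBF.eval_foldr_or, List.mem_filter, Finset.mem_toList,
    decide_eq_true_eq, and_assoc]

/-- The model sending a state `s` to the truth value of `w ∈ M.langOf (.var s)`. -/
noncomputable def SAFA.model {α : Type*} (M : SAFA α) : List α → M.Q → Bool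
  | [] => fun s => M.Fhat (.var s)
  | a :: w => fun s => (M.step a s).eval (M.model w)

theorem SAFA.Fhat_run {α : Type*} (M : SAFA α) (w : List α) (p : PBF M.Q) :
    M.Fhat (M.run w p) = p.eval (M.model w) := by
  induction w generalizing p with
  | nil => rfl
  | cons a w ih => exact (ih _).trans (PBF.eval_subst _ _ _)

theorem SAFA.mem_inter_Δ {α : Type*} (M M' : SAFA α)
    (t : (M.Q ⊕ M'.Q) × Set α × PBF (M.Q ⊕ M'.Q)) :
    t ∈ (M.inter M').Δ ↔
      (∃ u ∈ M.Δ, (Sum.inl u.1, u.2.1, u.2.2.subst (.var ∘ Sum.inl)) = t) ∨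
      (∃ u ∈ M'.Δ, (Sum.inr u.1, u.2.1, u.2.2.subst (.var ∘ Sum.inr)) = t) := by
  let := Classical.decEq ((M.Q ⊕ M'.Q) × Set α × PBF (M.Q ⊕ M'.Q))
  exact Finset.mem_union.trans (or_congr Finset.mem_image Finset.mem_image)

theorem SAFA.model_inter_inl {α : Type*} (M M' : SAFA α) (w : List α) (s : M.Q) :
    (M.inter M').model w (Sum.inl s : M.Q ⊕ M'.Q) = M.model w s := by
  induction w generalizing s with
  | nil =>
    have mem_F : (Sum.inl s : M.Q ⊕ M'.Q) ∈ Sum.inl '' M.F ∪ Sum.inr '' M'.F ↔ s ∈ M.F := by simp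
    exact decide_eq_decide.2 mem_F
  | cons a w ih =>
    rw [Bool.eq_iff_iff]
    refine (SAFA.eval_step _ _ _ _).trans (Iff.trans ?_ (SAFA.eval_step _ _ _ _).symm)
    have eval_inl (p : PBF M.Q) :
        PBF.eval ((M.inter M').model w) (p.subst (PBF.var ∘ Sum.inl) : PBF (M.Q ⊕ M'.Q)) =
          p.eval (M.model w) :=
      PBF.eval_subst_var _ _ ih p
    constructor
    · rintro ⟨t, ht, hs, ha, he⟩
      obtain ⟨u, hu, rfl⟩ | ⟨u, hu, rfl⟩ := (SAFA.mem_inter_Δ M M' t).1 ht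
      · exact ⟨u, hu, Sum.inl.inj hs, ha, (eval_inl _).symm.trans he⟩
      · cases hs
    · rintro ⟨u, hu, rfl, ha, he⟩
      exact ⟨_, (SAFA.mem_inter_Δ M M' _).2 (.inl ⟨u, hu, rfl⟩), rfl, ha, (eval_inl _).trans he⟩

theorem SAFA.model_inter_inr {α : Type*} (M M' : SAFA α) (w : List α) (s : M'.Q) :
    (M.inter M').model w (Sum.inr s : M.Q ⊕ M'.Q) = M'.model w s := by
  induction w generalizing s with
  | nil =>
    have mem_F : (Sum.inr s : M.Q ⊕ M'.Q) ∈ Sum.inl '' M.F ∪ Sum.inr '' M'.F ↔ s ∈ M'.F := by simp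
    exact decide_eq_decide.2 mem_F
  | cons a w ih =>
    rw [Bool.eq_iff_iff]
    refine (SAFA.eval_step _ _ _ _).trans (Iff.trans ?_ (SAFA.eval_step _ _ _ _).symm)
    have eval_inr (p : PBF M'.Q) :
        PBF.eval ((M.inter M').model w) (p.subst (PBF.var ∘ Sum.inr) : PBF (M.Q ⊕ M'.Q)) =
          p.eval (M'.model w) :=
      PBF.eval_subst_var _ _ ih p
    constructor
    · rintro ⟨t, ht, hs, ha, he⟩
      obtain ⟨u, hu, rfl⟩ | ⟨u, hu, rfl⟩ := (SAFA.mem_inter_Δ M M' t).1 ht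
      · cases hs
      · exact ⟨u, hu, Sum.inr.inj hs, ha, (eval_inr _).symm.trans he⟩
    · rintro ⟨u, hu, rfl, ha, he⟩
      exact ⟨_, (SAFA.mem_inter_Δ M M' _).2 (.inr ⟨u, hu, rfl⟩), rfl, ha, (eval_inr _).trans he⟩

/-- The intersection construction recognizes the intersection of the languages. -/
theorem stmt_10 {α : Type*} (M M' : SAFA α) :
    (M.inter M').lang = M.lang ∩ M'.lang := by
  ext w
  have eval_inl : PBF.eval ((M.inter M').model w)
      (M.init.subst (PBF.var ∘ Sum.inl) : PBF (M.Q ⊕ M'.Q)) = M.init.eval (M.model w) :=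
    PBF.eval_subst_var _ _ (M.model_inter_inl M' w) _
  have eval_inr : PBF.eval ((M.inter M').model w)
      (M'.init.subst (PBF.var ∘ Sum.inr) : PBF (M.Q ⊕ M'.Q)) = M'.init.eval (M'.model w) :=
    PBF.eval_subst_var _ _ (M.model_inter_inr M' w) _
  simp only [SAFA.lang, SAFA.langOf, Set.mem_inter_iff, Set.mem_ofPred_eq, SAFA.Fhat_run]
  rw [← eval_inl, ← eval_inr]
  exact Bool.and_eq_true_iff
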